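/- arXiv:1707.03174 — 7 statements merged into one kernel-verified Lean document; each statement's English description precedes it below -/
import Mathlib

section
/- Let m,n,p ≥ 3 and let ∘₁ and ∘₂ each be one of union, intersection, or symmetric difference of languages. (i) For all regular languages L₁, L₂, L₃ over a common finite alphabet whose state complexities are at most m, n, p respectively, the state complexity of (L₁ ∘₁ L₂) ∘₂ L₃ is at most m·n·p. (ii) Over the two-letter alphabet {a,b}, the languages K₁ = L(X_m(a,−,−;{b})), K₂ = L(X_n(a,b,−;∅)), K₃ = L(X_p(b,−,−;{a})) have state complexities exactly m, n, p and satisfy sc((K₁ ∘₁ K₂) ∘₂ K₃) = m·n·p. -/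
/-- The cyclic permutation `i ↦ i+1 mod n` on `{0,…,n−1}`. -/
def cyc {n : ℕ} (i : Fin n) : Fin n := ⟨(i.val + 1) % n, Nat.mod_lt _ i.pos⟩

/-- The transposition exchanging `0` and `1` and fixing all other elements of `{0,…,n−1}`. -/
def transp {n : ℕ} (i : Fin n) : Fin n :=
  if i.val = 0 then ⟨1 % n, Nat.mod_lt _ i.pos⟩
  else if i.val = 1 then ⟨0, i.pos⟩ else i

/-- The contraction sending `1` to `0` and fixing all other elements of `{0,…,n−1}`. -/
def contr {n : ℕ} (i : Fin n) : Fin n := if i.val = 1 then ⟨0, i.pos⟩ else i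

/-- A Brzozowski-type complete DFA: state set `{0,…,n−1}`, initial state `0`,
unique final state `n−1`, where each letter `x` acts as the transformation `f x`. -/
def brzDFA {α : Type} (n : ℕ) (hn : 0 < n) (f : α → Fin n → Fin n) : DFA α (Fin n) where
  step q x := f x q
  start := ⟨0, hn⟩
  accept := {⟨n - 1, Nat.sub_lt hn Nat.one_pos⟩}

/-- The state complexity of a language: the least number of states of a complete
DFA recognizing it. -/
noncomputable def sc {α : Type} (L : Language α) : ℕ :=
  sInf {n | ∃ M : DFA α (Fin n), M.accepts = L}

/-- The two-letter alphabet `{a,b}`. -/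
inductive Two | a | b

/-- A boolean operation among union, intersection and symmetric difference. -/
inductive BoolOp | union | inter | xor

/-- Application of a boolean operation to languages. -/
def BoolOp.app (o : BoolOp) {α : Type} (K K' : Language α) : Language α :=
  match o with
  | .union => K ⊔ K'
  | .inter => K ⊓ K'
  | .xor => symmDiff K K'

/-- `L(X_m(a,−,−;{b}))`: `a` is the cycle, `b` the identity. -/
def K1 (m : ℕ) (hm : 0 < m) : Language Two :=
  (brzDFA m hm (fun x q => match x with | Two.a => cyc q | Two.b => q)).accepts

/-- `L(X_n(a,b,−;∅))`: `a` is the cycle, `b` the transposition. -/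
def K2 (n : ℕ) (hn : 0 < n) : Language Two :=
  (brzDFA n hn (fun x q => match x with | Two.a => cyc q | Two.b => transp q)).accepts

/-- `L(X_p(b,−,−;{a}))`: `b` is the cycle, `a` the identity. -/
def K3 (p : ℕ) (hp : 0 < p) : Language Two :=
  (brzDFA p hp (fun x q => match x with | Two.a => q | Two.b => cyc q)).accepts

/-- The action of a boolean operation on truth values. -/
def BoolOp.ev (o : BoolOp) (u v : Prop) : Prop :=
  match o with
  | .union => u ∨ v
  | .inter => u ∧ v
  | .xor => (u ∧ ¬ v) ∨ (v ∧ ¬ u)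

theorem BoolOp.mem_app (o : BoolOp) {α : Type} (K K' : Language α) (w : List α) :
    w ∈ o.app K K' ↔ o.ev (w ∈ K) (w ∈ K') := by
  cases o <;> exact Iff.rfl

/-- The product automaton recognizing a boolean combination of two languages. -/
def boolDFA (o : BoolOp) {α σ τ : Type} (M : DFA α σ) (N : DFA α τ) : DFA α (σ × τ) where
  step q x := (M.step q.1 x, N.step q.2 x)
  start := (M.start, N.start)
  accept := {q | o.ev (q.1 ∈ M.accept) (q.2 ∈ N.accept)}

theorem boolDFA_evalFrom (o : BoolOp) {α σ τ : Type} (M : DFA α σ) (N : DFA α τ)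
    (w : List α) (q : σ × τ) :
    (boolDFA o M N).evalFrom q w = (M.evalFrom q.1 w, N.evalFrom q.2 w) := by
  induction w generalizing q with
  | nil => rfl
  | cons x w ih => rw [DFA.evalFrom_cons, ih]; rfl

theorem boolDFA_accepts (o : BoolOp) {α σ τ : Type} (M : DFA α σ) (N : DFA α τ) :
    (boolDFA o M N).accepts = o.app M.accepts N.accepts := by
  ext w
  rw [BoolOp.mem_app, DFA.mem_accepts, DFA.eval, boolDFA_evalFrom]
  rfl

theorem exists_fin_card_dfa {α σ : Type} [Fintype σ] (M : DFA α σ) :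
    ∃ M' : DFA α (Fin (Fintype.card σ)), M'.accepts = M.accepts :=
  ⟨DFA.reindex (Fintype.equivFin σ) M, DFA.accepts_reindex M _⟩

/-- A DFA all of whose states are reachable and pairwise distinguishable is minimal. -/
theorem sc_eq_card {α σ : Type} [Fintype σ] (M : DFA α σ)
    (reach : ∀ q, ∃ w, M.eval w = q)
    (dist : ∀ q q', q ≠ q' → ∃ w, M.evalFrom q w ∈ M.accept ∧ M.evalFrom q' w ∉ M.accept) :
    sc M.accepts = Fintype.card σ := by
  apply le_antisymm
  · exact Nat.sInf_le (exists_fin_card_dfa M)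
  · refine le_csInf (Set.nonempty_of_mem (exists_fin_card_dfa M)) ?_
    rintro k ⟨N, hN⟩
    choose f hf using reach
    have inj : Function.Injective fun q => N.eval (f q) := by
      intro q q' h
      by_contra hne
      obtain ⟨w, hw, hw'⟩ := dist q q' hne
      have key : ∀ r, f r ++ w ∈ M.accepts ↔ M.evalFrom r w ∈ M.accept := by
        intro r
        rw [DFA.mem_accepts, DFA.eval, DFA.evalFrom_of_append, ← DFA.eval, hf]
      have key' : ∀ r, f r ++ w ∈ N.accepts ↔ N.evalFrom (N.eval (f r)) w ∈ N.accept := by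
        intro r
        rw [DFA.mem_accepts, DFA.eval, DFA.evalFrom_of_append, ← DFA.eval]
      have h₁ := (key q).2 hw
      rw [← hN, key'] at h₁
      refine hw' ((key q').1 ?_)
      rw [← hN, key']
      exact (congrArg (fun r => N.evalFrom r w ∈ N.accept) h).mp h₁
    simpa using Fintype.card_le_of_injective _ inj

theorem cyc_iterate_val {n : ℕ} (k : ℕ) (i : Fin n) : (cyc^[k] i).val = (i.val + k) % n := by
  induction k with
  | zero => simp [Nat.mod_eq_of_lt i.isLt]
  | succ k ih =>
    rw [Function.iterate_succ_apply']
    simp [cyc, ih, Nat.add_assoc]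

theorem cyc_injective {n : ℕ} : Function.Injective (cyc : Fin n → Fin n) := by
  intro i j h
  have h' : (i.val + 1) % n = (j.val + 1) % n := congrArg Fin.val h
  exact Fin.ext ((Nat.ModEq.add_right_cancel' 1 h').eq_of_lt_of_lt i.isLt j.isLt)

theorem cyc_iterate_of_dvd {n k : ℕ} (h : n ∣ k) (i : Fin n) : cyc^[k] i = i := by
  obtain ⟨c, rfl⟩ := h
  apply Fin.ext
  rw [cyc_iterate_val, Nat.add_mul_mod_self_left, Nat.mod_eq_of_lt i.isLt]

theorem exists_cyc_iterate_eq {n : ℕ} (i j : Fin n) : ∃ x, cyc^[x] i = j := by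
  refine ⟨n - i.val + j.val, Fin.ext ?_⟩
  rw [cyc_iterate_val, show i.val + (n - i.val + j.val) = j.val + n by omega,
    Nat.add_mod_right, Nat.mod_eq_of_lt j.isLt]

theorem exists_cyc_iterate_ne {n : ℕ} (hn : 3 ≤ n) (i i' l : Fin n) :
    ∃ x, cyc^[x] i ≠ l ∧ cyc^[x] i' ≠ l := by
  by_contra! h
  have hmod : ∀ r : ℕ, r < n → ∀ x, x < 3 →
      (r + x) % n = if r + x < n then r + x else r + x - n := by
    intro r hr x hx
    split_ifs with hlt
    · exact Nat.mod_eq_of_lt hlt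
    · rw [Nat.mod_eq_sub_mod (by omega), Nat.mod_eq_of_lt (by omega)]
  have key : ∀ x, x < 3 → (i.val + x) % n = l.val ∨ (i'.val + x) % n = l.val := by
    intro x _
    rw [← cyc_iterate_val, ← cyc_iterate_val, ← Fin.ext_iff, ← Fin.ext_iff]
    exact or_iff_not_imp_left.2 (h x)
  have h₀ := key 0 (by omega)
  have h₁ := key 1 (by omega)
  have h₂ := key 2 (by omega)
  simp only [hmod _ i.isLt _ (show 0 < 3 by omega), hmod _ i.isLt _ (show 1 < 3 by omega),
    hmod _ i.isLt _ (show 2 < 3 by omega), hmod _ i'.isLt _ (show 0 < 3 by omega),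
    hmod _ i'.isLt _ (show 1 < 3 by omega), hmod _ i'.isLt _ (show 2 < 3 by omega)] at h₀ h₁ h₂
  have := i.isLt
  have := i'.isLt
  split_ifs at h₀ h₁ h₂ <;> omega

theorem transp_transp {n : ℕ} (hn : 2 ≤ n) (i : Fin n) : transp (transp i) = i := by
  have h1 : 1 % n = 1 := Nat.mod_eq_of_lt hn
  apply Fin.ext
  by_cases h₀ : i.val = 0
  · simp [transp, h₀, h1]
  · by_cases h₁ : i.val = 1 <;> simp [transp, h₀, h₁, h1]

theorem evalFrom_replicate {α σ : Type} (M : DFA α σ) (x : α) (k : ℕ) (q : σ) :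
    M.evalFrom q (List.replicate k x) = (fun r => M.step r x)^[k] q := by
  induction k generalizing q with
  | zero => rfl
  | succ k ih => rw [List.replicate_succ, DFA.evalFrom_cons, ih, Function.iterate_succ_apply]

theorem evalFrom_injective {α σ : Type} (M : DFA α σ)
    (h : ∀ x, Function.Injective fun q => M.step q x) (w : List α) :
    Function.Injective fun q => M.evalFrom q w := by
  induction w with
  | nil => exact fun _ _ h => h
  | cons x w ih => exact ih.comp (h x)

theorem sc_brzDFA {α : Type} (n : ℕ) (hn : 0 < n) (f : α → Fin n → Fin n) (x : α)
    (hx : f x = cyc) : sc (brzDFA n hn f).accepts = n := by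
  have hev : ∀ k q, (brzDFA n hn f).evalFrom q (List.replicate k x) = cyc^[k] q := by
    intro k q
    rw [evalFrom_replicate, ← hx]
    rfl
  rw [sc_eq_card, Fintype.card_fin]
  · intro q
    obtain ⟨k, hk⟩ := exists_cyc_iterate_eq (⟨0, hn⟩ : Fin n) q
    exact ⟨List.replicate k x, (hev k _).trans hk⟩
  · intro q q' hne
    obtain ⟨k, hk⟩ := exists_cyc_iterate_eq q ⟨n - 1, Nat.sub_lt hn Nat.one_pos⟩
    refine ⟨List.replicate k x, (hev k q).trans hk, fun h => hne ?_⟩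
    exact cyc_injective.iterate k (hk.trans ((hev k q').symm.trans h).symm)

/-- The automaton `X_m(a,−,−;{b})`. -/
def dfa1 (m : ℕ) (hm : 0 < m) : DFA Two (Fin m) :=
  brzDFA m hm (fun x q => match x with | Two.a => cyc q | Two.b => q)

/-- The automaton `X_n(a,b,−;∅)`. -/
def dfa2 (n : ℕ) (hn : 0 < n) : DFA Two (Fin n) :=
  brzDFA n hn (fun x q => match x with | Two.a => cyc q | Two.b => transp q)

/-- The automaton `X_p(b,−,−;{a})`. -/
def dfa3 (p : ℕ) (hp : 0 < p) : DFA Two (Fin p) :=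
  brzDFA p hp (fun x q => match x with | Two.a => q | Two.b => cyc q)

section Words

variable {m n p : ℕ} (hm : 0 < m) (hn : 0 < n) (hp : 0 < p)

theorem dfa1_replicate_a (k : ℕ) (q : Fin m) :
    (dfa1 m hm).evalFrom q (List.replicate k .a) = cyc^[k] q :=
  evalFrom_replicate _ _ _ _

theorem dfa1_replicate_b (k : ℕ) (q : Fin m) :
    (dfa1 m hm).evalFrom q (List.replicate k .b) = q :=
  (evalFrom_replicate _ _ _ _).trans (congrFun (Function.iterate_id k) q)

theorem dfa2_replicate_a (k : ℕ) (q : Fin n) :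
    (dfa2 n hn).evalFrom q (List.replicate k .a) = cyc^[k] q :=
  evalFrom_replicate _ _ _ _

theorem dfa2_replicate_b (k : ℕ) (q : Fin n) :
    (dfa2 n hn).evalFrom q (List.replicate k .b) = transp^[k] q :=
  evalFrom_replicate _ _ _ _

theorem dfa3_replicate_a (k : ℕ) (q : Fin p) :
    (dfa3 p hp).evalFrom q (List.replicate k .a) = q :=
  (evalFrom_replicate _ _ _ _).trans (congrFun (Function.iterate_id k) q)

theorem dfa3_replicate_b (k : ℕ) (q : Fin p) :
    (dfa3 p hp).evalFrom q (List.replicate k .b) = cyc^[k] q :=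
  evalFrom_replicate _ _ _ _

theorem dfa2_evalFrom_injective (hn' : 2 ≤ n) (w : List Two) :
    Function.Injective fun q => (dfa2 n hn).evalFrom q w := by
  apply evalFrom_injective
  rintro (_ | _)
  · exact cyc_injective
  · exact Function.LeftInverse.injective (transp_transp hn')

/-- A conjugate of the commutator of `a` and `b` moves a given state of the second automaton one
step backwards and acts trivially on the first and third automata. -/
theorem exists_word_pred (hn' : 3 ≤ n) (j : Fin n) :
    ∃ w : List Two, (∀ i, (dfa1 m hm).evalFrom i w = i) ∧
      (∀ k, (dfa3 p hp).evalFrom k w = k) ∧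
      (dfa2 n hn).evalFrom j w = cyc^[n - 1] j := by
  obtain ⟨r, hr⟩ := exists_cyc_iterate_eq j ⟨0, hn⟩
  have hmn : 0 < m * n := Nat.mul_pos hm hn
  refine ⟨List.replicate r .a ++ (List.replicate 1 .a ++ List.replicate 1 .b ++
    List.replicate (m * n - 1) .a ++ List.replicate (2 * p - 1) .b) ++
    List.replicate ((m * n - 1) * r) .a, fun i => ?_, fun k => ?_, ?_⟩
  · simp only [DFA.evalFrom_of_append, dfa1_replicate_a, dfa1_replicate_b,
      ← Function.iterate_add_apply]
    apply cyc_iterate_of_dvd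
    obtain ⟨c, hc⟩ : ∃ c, m * n = c + 1 := ⟨m * n - 1, by omega⟩
    rw [show (m * n - 1) * r + (m * n - 1 + (1 + r)) = m * n * (r + 1) by
      rw [hc, Nat.add_sub_cancel]; ring]
    exact Dvd.intro _ (Nat.mul_assoc _ _ _).symm
  · simp only [DFA.evalFrom_of_append, dfa3_replicate_a, dfa3_replicate_b,
      ← Function.iterate_add_apply]
    exact cyc_iterate_of_dvd ⟨2, by omega⟩ k
  · simp only [DFA.evalFrom_of_append, dfa2_replicate_a, dfa2_replicate_b, hr]
    have h₁ : transp^[1] (cyc^[1] (⟨0, hn⟩ : Fin n)) = ⟨0, hn⟩ := by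
      apply Fin.ext
      simp [transp, cyc, Nat.mod_eq_of_lt (show 1 < n by omega)]
    obtain ⟨c, hc⟩ : ∃ c, m * n - 1 = c * n + (n - 1) := by
      obtain ⟨d, rfl⟩ : ∃ d, m = d + 1 := ⟨m - 1, by omega⟩
      exact ⟨d, by rw [Nat.add_mul]; omega⟩
    have h₂ : cyc^[m * n - 1] (⟨0, hn⟩ : Fin n) = ⟨n - 1, by omega⟩ := by
      apply Fin.ext
      rw [cyc_iterate_val, hc]
      simp [Nat.mod_eq_of_lt (show n - 1 < n by omega)]
    have h₃ : transp^[2 * p - 1] (⟨n - 1, by omega⟩ : Fin n) = ⟨n - 1, by omega⟩ := by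
      apply Function.iterate_fixed
      simp [transp, show n - 1 ≠ 0 by omega, show n - 1 ≠ 1 by omega]
    have h₄ : (⟨n - 1, by omega⟩ : Fin n) = cyc^[n - 1] (cyc^[r] j) := by
      rw [hr]
      apply Fin.ext
      rw [cyc_iterate_val]
      simp [Nat.mod_eq_of_lt (show n - 1 < n by omega)]
    rw [h₁, h₂, h₃, h₄]
    simp only [← Function.iterate_add_apply]
    rw [show (m * n - 1) * r + (n - 1 + r) = n - 1 + n * (m * r) by
      obtain ⟨d, hd⟩ : ∃ d, m * n = d + 1 := ⟨m * n - 1, by omega⟩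
      rw [hd, Nat.add_sub_cancel, show n * (m * r) = m * n * r by ring, hd]; ring,
      Function.iterate_add_apply, cyc_iterate_of_dvd (Dvd.intro _ rfl)]

theorem exists_word_trivial (hn' : 3 ≤ n) (j j' : Fin n) :
    ∃ w : List Two, (∀ i, (dfa1 m hm).evalFrom i w = i) ∧
      (∀ k, (dfa3 p hp).evalFrom k w = k) ∧ (dfa2 n hn).evalFrom j w = j' := by
  have key : ∀ x, ∃ w : List Two, (∀ i, (dfa1 m hm).evalFrom i w = i) ∧
      (∀ k, (dfa3 p hp).evalFrom k w = k) ∧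
      (dfa2 n hn).evalFrom j w = (cyc^[n - 1])^[x] j := by
    intro x
    induction x with
    | zero => exact ⟨[], fun _ => rfl, fun _ => rfl, rfl⟩
    | succ x ih =>
      obtain ⟨w, h₁, h₃, h₂⟩ := ih
      obtain ⟨v, g₁, g₃, g₂⟩ := exists_word_pred hm hn hp hn' ((cyc^[n - 1])^[x] j)
      refine ⟨w ++ v, fun i => ?_, fun k => ?_, ?_⟩
      · rw [DFA.evalFrom_of_append, h₁, g₁]
      · rw [DFA.evalFrom_of_append, h₃, g₃]
      · rw [DFA.evalFrom_of_append, h₂, g₂, Function.iterate_succ_apply' (cyc^[n - 1])]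
  obtain ⟨x, hx⟩ := exists_cyc_iterate_eq j' j
  obtain ⟨w, h₁, h₃, h₂⟩ := key x
  refine ⟨w, h₁, h₃, h₂.trans ?_⟩
  rw [← hx, ← Function.iterate_mul, ← Function.iterate_add_apply]
  apply cyc_iterate_of_dvd
  refine ⟨x, ?_⟩
  obtain ⟨d, rfl⟩ : ∃ d, n = d + 1 := ⟨n - 1, by omega⟩
  rw [Nat.add_sub_cancel]
  ring

/-- The first and third automata can be rotated by any amounts while a given state of the second
automaton is sent to any other one. -/
theorem exists_word (hn' : 3 ≤ n) (x z : ℕ) (j j' : Fin n) :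
    ∃ w : List Two, (∀ i, (dfa1 m hm).evalFrom i w = cyc^[x] i) ∧
      (∀ k, (dfa3 p hp).evalFrom k w = cyc^[z] k) ∧ (dfa2 n hn).evalFrom j w = j' := by
  obtain ⟨w, h₁, h₃, h₂⟩ := exists_word_trivial hm hn hp hn'
    ((dfa2 n hn).evalFrom j (List.replicate x .a ++ List.replicate z .b)) j'
  refine ⟨List.replicate x .a ++ List.replicate z .b ++ w, fun i => ?_, fun k => ?_, ?_⟩
  · simp only [DFA.evalFrom_of_append, dfa1_replicate_a, dfa1_replicate_b, h₁]
  · simp only [DFA.evalFrom_of_append, dfa3_replicate_a, dfa3_replicate_b, h₃]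
  · rw [DFA.evalFrom_of_append, h₂]

theorem sc_boolDFA (hm' : 3 ≤ m) (hn' : 3 ≤ n) (hp' : 3 ≤ p) (o₁ o₂ : BoolOp) :
    sc (boolDFA o₂ (boolDFA o₁ (dfa1 m hm) (dfa2 n hn)) (dfa3 p hp)).accepts = m * n * p := by
  rw [sc_eq_card]
  · simp
  · rintro ⟨⟨i, j⟩, k⟩
    obtain ⟨x, hx⟩ := exists_cyc_iterate_eq ⟨0, hm⟩ i
    obtain ⟨z, hz⟩ := exists_cyc_iterate_eq ⟨0, hp⟩ k
    obtain ⟨w, h₁, h₃, h₂⟩ := exists_word hm hn hp hn' x z ⟨0, hn⟩ j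
    refine ⟨w, ?_⟩
    rw [DFA.eval, boolDFA_evalFrom, boolDFA_evalFrom]
    exact Prod.ext (Prod.ext ((h₁ _).trans hx) h₂) ((h₃ _).trans hz)
  · rintro ⟨⟨i, j⟩, k⟩ ⟨⟨i', j'⟩, k'⟩ hne
    set l₁ : Fin m := ⟨m - 1, Nat.sub_lt hm Nat.one_pos⟩ with hl₁
    set l₂ : Fin n := ⟨n - 1, Nat.sub_lt hn Nat.one_pos⟩ with hl₂
    set l₃ : Fin p := ⟨p - 1, Nat.sub_lt hp Nat.one_pos⟩ with hl₃
    -- It suffices to separate the two states by rotations and a move of `j`.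
    suffices h : ∃ x z t, o₂.ev (o₁.ev (cyc^[x] i = l₁) (t = l₂)) (cyc^[z] k = l₃) ∧
        ∀ t', (t = t' ↔ j = j') →
          ¬ o₂.ev (o₁.ev (cyc^[x] i' = l₁) (t' = l₂)) (cyc^[z] k' = l₃) by
      obtain ⟨x, z, t, h, h'⟩ := h
      obtain ⟨w, h₁, h₃, h₂⟩ := exists_word hm hn hp hn' x z j t
      refine ⟨w, ?_, ?_⟩
      · rw [boolDFA_evalFrom, boolDFA_evalFrom, h₁, h₂, h₃]
        exact h
      · rw [boolDFA_evalFrom, boolDFA_evalFrom, h₁, h₃]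
        refine h' ((dfa2 n hn).evalFrom j' w) ?_
        rw [← h₂]
        exact (dfa2_evalFrom_injective hn (by omega) w).eq_iff
    obtain ⟨x₁, hx₁⟩ := exists_cyc_iterate_eq i l₁
    have hx₁' : cyc^[x₁] i' = l₁ ↔ i' = i := by
      rw [← hx₁]; exact (cyc_injective.iterate x₁).eq_iff
    obtain ⟨x₀, hx₀, hx₀'⟩ := exists_cyc_iterate_ne hm' i i' l₁
    obtain ⟨z₁, hz₁⟩ := exists_cyc_iterate_eq k l₃
    have hz₁' : cyc^[z₁] k' = l₃ ↔ k' = k := by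
      rw [← hz₁]; exact (cyc_injective.iterate z₁).eq_iff
    obtain ⟨z₀, hz₀, hz₀'⟩ := exists_cyc_iterate_ne hp' k k' l₃
    have hl₀ : (⟨0, hn⟩ : Fin n) ≠ l₂ := by
      rw [hl₂, Ne, Fin.mk.injEq]; omega
    by_cases hij : i = i' ∧ j = j'
    · obtain ⟨rfl, rfl⟩ := hij
      have hk : k' ≠ k := fun h => hne (by rw [h])
      cases o₂
      case inter =>
        by_cases hxor : o₁.ev True True
        · refine ⟨x₁, z₁, l₂, ⟨by simpa [hx₁] using hxor, hz₁⟩, fun t' _ hc => hk (hz₁'.1 hc.2)⟩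
        · refine ⟨x₁, z₁, ⟨0, hn⟩, ⟨?_, hz₁⟩, fun t' _ hc => hk (hz₁'.1 hc.2)⟩
          cases o₁ <;> simp_all [BoolOp.ev]
      all_goals
        refine ⟨x₀, z₁, ⟨0, hn⟩, ?_, fun t' ht => ?_⟩
        · cases o₁ <;> simp_all [BoolOp.ev]
        · obtain rfl := ht.2 rfl
          cases o₁ <;> simp_all [BoolOp.ev]
    · -- Make the combination of the first two coordinates true for one state only.
      have key : ∃ x t, o₁.ev (cyc^[x] i = l₁) (t = l₂) ∧
          ∀ t', (t = t' ↔ j = j') → ¬ o₁.ev (cyc^[x] i' = l₁) (t' = l₂) := by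
        by_cases hj : j = j'
        · have hi : i' ≠ i := fun h => hij ⟨h.symm, hj⟩
          cases o₁
          case inter => exact ⟨x₁, l₂, ⟨hx₁, rfl⟩, fun t' _ hc => hi (hx₁'.1 hc.1)⟩
          all_goals
            refine ⟨x₁, ⟨0, hn⟩, ?_, fun t' ht => ?_⟩
            · simp_all [BoolOp.ev]
            · obtain rfl := ht.2 hj
              simp_all [BoolOp.ev]
        · have ht' : ∀ t', (l₂ = t' ↔ j = j') → t' ≠ l₂ := fun t' ht h => hj (ht.1 h.symm)
          cases o₁
          case inter => exact ⟨x₁, l₂, ⟨hx₁, rfl⟩, fun t' ht hc => ht' t' ht hc.2⟩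
          case union => exact ⟨x₀, l₂, Or.inr rfl, fun t' ht hc => hc.elim hx₀' (ht' t' ht)⟩
          case xor =>
            exact ⟨x₀, l₂, Or.inr ⟨rfl, hx₀⟩, fun t' ht hc => hc.elim (fun c => hx₀' c.1)
              fun c => ht' t' ht c.1⟩
      obtain ⟨x, t, h, h'⟩ := key
      cases o₂
      case inter => exact ⟨x, z₁, t, ⟨h, hz₁⟩, fun t' ht hc => h' t' ht hc.1⟩
      case union => exact ⟨x, z₀, t, Or.inl h, fun t' ht hc => hc.elim (h' t' ht) hz₀'⟩
      case xor =>
        exact ⟨x, z₀, t, Or.inl ⟨h, hz₀⟩, fun t' ht hc => hc.elim (fun c => h' t' ht c.1)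
          fun c => hz₀' c.1⟩

end Words

theorem statement0 (o₁ o₂ : BoolOp) (m n p : ℕ) (hm : 3 ≤ m) (hn : 3 ≤ n) (hp : 3 ≤ p) :
    (∀ (α : Type) [Fintype α] (L₁ L₂ L₃ : Language α),
        (∃ k ≤ m, ∃ M : DFA α (Fin k), M.accepts = L₁) →
        (∃ k ≤ n, ∃ M : DFA α (Fin k), M.accepts = L₂) →
        (∃ k ≤ p, ∃ M : DFA α (Fin k), M.accepts = L₃) →
        ∃ k ≤ m * n * p, ∃ M : DFA α (Fin k), M.accepts = o₂.app (o₁.app L₁ L₂) L₃) ∧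
    sc (K1 m (by omega)) = m ∧ sc (K2 n (by omega)) = n ∧ sc (K3 p (by omega)) = p ∧
    sc (o₂.app (o₁.app (K1 m (by omega)) (K2 n (by omega))) (K3 p (by omega))) = m * n * p := by
  refine ⟨?_, sc_brzDFA m _ _ .a rfl, sc_brzDFA n _ _ .a rfl, sc_brzDFA p _ _ .b rfl, ?_⟩
  · rintro α _ L₁ L₂ L₃ ⟨k₁, hk₁, M₁, rfl⟩ ⟨k₂, hk₂, M₂, rfl⟩ ⟨k₃, hk₃, M₃, rfl⟩
    obtain ⟨M, hM⟩ := exists_fin_card_dfa (boolDFA o₂ (boolDFA o₁ M₁ M₂) M₃)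
    refine ⟨_, ?_, M, by rw [hM, boolDFA_accepts, boolDFA_accepts]⟩
    simpa using Nat.mul_le_mul (Nat.mul_le_mul hk₁ hk₂) hk₃
  · have h := sc_boolDFA (m := m) (n := n) (p := p) (by omega) (by omega) (by omega) hm hn hp o₁ o₂
    rwa [boolDFA_accepts, boolDFA_accepts] at h
end

section
/- Let m,n,p ≥ 3 and let D be the DFA over alphabet {a,b} with state set {0,…,m−1}×{0,…,n−1}×{0,…,p−1}, initial state (0,0,0), where letter a sends (i,j,k) to (i+1 mod m, j+1 mod n, k) and letter b sends (i,j,k) to (i, τ(j), k+1 mod p), τ being the transposition exchanging 0 and 1 and fixing all other elements of {0,…,n−1}. Then every state (i,j,k) of D is reachable from (0,0,0), i.e., for every (i,j,k) there exists a word w ∈ {a,b}* with (0,0,0)·w = (i,j,k). -/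
/-- The transition function of the product DFA `D` of `X_m(a,−,−;{b})`,
`X_n(a,b,−;∅)` and `X_p(b,−,−;{a}})`:
`a` sends `(i,j,k)` to `(i+1 mod m, j+1 mod n, k)` and
`b` sends `(i,j,k)` to `(i, τ(j), k+1 mod p)`. -/
def Dstep (m n p : ℕ) : (Fin m × Fin n × Fin p) → Two → (Fin m × Fin n × Fin p)
  | (i, j, k), Two.a => (cyc i, cyc j, k)
  | (i, j, k), Two.b => (i, transp j, cyc k)

theorem iterate_cyc_val {n : ℕ} (i : Fin n) (t : ℕ) : (cyc^[t] i).val = (i.val + t) % n := by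
  induction t with
  | zero => simp [Nat.mod_eq_of_lt i.isLt]
  | succ t ih =>
    rw [Function.iterate_succ_apply']
    simp only [cyc, ih]
    rw [Nat.mod_add_mod, add_assoc]

theorem cyc_induction {n : ℕ} {P : Fin n → Prop} {i : Fin n} (base : P i)
    (step : ∀ j, P j → P (cyc j)) (j : Fin n) : P j := by
  have hP : ∀ t, P (cyc^[t] i) := fun t => by
    induction t with
    | zero => exact base
    | succ t ih => rw [Function.iterate_succ_apply']; exact step _ ih
  have hj : cyc^[n - i.val + j.val] i = j := by
    apply Fin.ext
    rw [iterate_cyc_val, ← add_assoc, Nat.add_sub_cancel' i.isLt.le, Nat.add_mod_left,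
      Nat.mod_eq_of_lt j.isLt]
  exact hj ▸ hP _

theorem cyc_surjective {n : ℕ} : Function.Surjective (cyc : Fin n → Fin n) := fun j =>
  cyc_induction (P := fun j => ∃ i, cyc i = j) ⟨j, rfl⟩ (fun i _ => ⟨i, rfl⟩) j

theorem transp_involutive {n : ℕ} (hn : 2 ≤ n) :
    Function.Involutive (transp : Fin n → Fin n) := by
  intro i
  have h1 : 1 % n = 1 := Nat.mod_eq_of_lt hn
  apply Fin.ext
  unfold transp
  split_ifs <;> simp_all

theorem Dstep_injective {m n p : ℕ} (hn : 2 ≤ n) (x : Two) :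
    Function.Injective fun s => Dstep m n p s x := by
  rw [Finite.injective_iff_surjective]
  rintro ⟨i, j, k⟩
  cases x with
  | a =>
    obtain ⟨i, rfl⟩ := cyc_surjective i
    obtain ⟨j, rfl⟩ := cyc_surjective j
    exact ⟨(i, j, k), rfl⟩
  | b =>
    obtain ⟨j, rfl⟩ := (transp_involutive hn).surjective j
    obtain ⟨k, rfl⟩ := cyc_surjective k
    exact ⟨(i, j, k), rfl⟩

/-- The state `t` is reachable from the state `s` in the product DFA. -/
def Reach {m n p : ℕ} (s t : Fin m × Fin n × Fin p) : Prop :=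
  ∃ w : List Two, w.foldl (Dstep m n p) s = t

namespace Reach

variable {m n p : ℕ} {s t u : Fin m × Fin n × Fin p}

theorem refl (s : Fin m × Fin n × Fin p) : Reach s s := ⟨[], rfl⟩

theorem trans : Reach s t → Reach t u → Reach s u := by
  rintro ⟨v, rfl⟩ ⟨w, rfl⟩
  exact ⟨v ++ w, List.foldl_append⟩

theorem step (s : Fin m × Fin n × Fin p) (x : Two) : Reach s (Dstep m n p s x) := ⟨[x], rfl⟩

theorem iterate (s : Fin m × Fin n × Fin p) (x : Two) (r : ℕ) :
    Reach s ((fun s => Dstep m n p s x)^[r] s) := by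
  induction r with
  | zero => exact refl s
  | succ r ih => rw [Function.iterate_succ_apply']; exact ih.trans (step _ x)

theorem step_back (hn : 2 ≤ n) (s : Fin m × Fin n × Fin p) (x : Two) :
    Reach (Dstep m n p s x) s := by
  obtain ⟨r, hr, h⟩ := (Dstep_injective (m := m) (p := p) hn x).mem_periodicPts s
  obtain ⟨r, rfl⟩ := Nat.exists_eq_succ_of_ne_zero hr.ne'
  have := iterate (Dstep m n p s x) x r
  rwa [← Function.iterate_succ_apply (fun s => Dstep m n p s x), h.eq] at this

theorem last_zero (hn : 3 ≤ n) (i : Fin m) (k : Fin p) :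
    Reach (i, (⟨n - 1, by omega⟩ : Fin n), k) (i, cyc ⟨n - 1, by omega⟩, k) := by
  have hn2 : 2 ≤ n := by omega
  have h0 : cyc (⟨n - 1, by omega⟩ : Fin n) = ⟨0, by omega⟩ := by
    simp [cyc, Nat.sub_add_cancel (by omega : 1 ≤ n)]
  have h1 : cyc (⟨0, by omega⟩ : Fin n) = ⟨1, by omega⟩ := by
    simp [cyc, Nat.mod_eq_of_lt hn2]
  have hlast : transp (⟨n - 1, by omega⟩ : Fin n) = ⟨n - 1, by omega⟩ := by
    simp [transp, show n - 1 ≠ 0 by omega, show n - 1 ≠ 1 by omega]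
  have hone : transp (⟨1, by omega⟩ : Fin n) = ⟨0, by omega⟩ := by simp [transp]
  have e1 := step (i, (⟨n - 1, by omega⟩ : Fin n), k) Two.b
  have e2 := step (i, (⟨n - 1, by omega⟩ : Fin n), cyc k) Two.a
  have e3 := step_back hn2 (cyc i, (⟨1, by omega⟩ : Fin n), k) Two.b
  have e4 := step_back hn2 (i, (⟨0, by omega⟩ : Fin n), k) Two.a
  simp only [Dstep, h0, h1, hlast, hone] at e1 e2 e3 e4 ⊢
  exact e1.trans (e2.trans (e3.trans e4))

theorem cyc_snd (hn : 3 ≤ n) (i : Fin m) (j : Fin n) (k : Fin p) :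
    Reach (i, j, k) (i, cyc j, k) := by
  induction j using cyc_induction generalizing i with
  | base => exact last_zero hn i k
  | step j ih =>
    obtain ⟨i, rfl⟩ := cyc_surjective i
    exact (step_back (by omega) (i, j, k) Two.a).trans
      ((ih i).trans (step (i, cyc j, k) Two.a))

theorem snd (hn : 3 ≤ n) (i : Fin m) (j j' : Fin n) (k : Fin p) :
    Reach (i, j, k) (i, j', k) :=
  cyc_induction (P := fun j' => Reach (i, j, k) (i, j', k)) (refl _)
    (fun j' h => h.trans (cyc_snd hn i j' k)) j'

theorem all (hn : 3 ≤ n) (s t : Fin m × Fin n × Fin p) : Reach s t := by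
  obtain ⟨i, j, k⟩ := s
  obtain ⟨i', j', k'⟩ := t
  have hi : Reach (i, j, k) (i', j, k) :=
    cyc_induction (P := fun i' => Reach (i, j, k) (i', j, k)) (refl _)
      (fun i' h => h.trans ((step (i', j, k) Two.a).trans (snd hn _ _ j k))) i'
  have hk : Reach (i', j, k) (i', j, k') :=
    cyc_induction (P := fun k' => Reach (i', j, k) (i', j, k')) (refl _)
      (fun k' h => h.trans ((step (i', j, k') Two.b).trans (snd hn i' _ j _))) k'
  exact hi.trans (hk.trans (snd hn i' j j' k'))

end Reach

theorem statement1 (m n p : ℕ) (hm : 3 ≤ m) (hn : 3 ≤ n) (hp : 3 ≤ p)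
    (s : Fin m × Fin n × Fin p) :
    ∃ w : List Two,
      w.foldl (Dstep m n p) ((⟨0, by omega⟩ : Fin m), (⟨0, by omega⟩ : Fin n),
        (⟨0, by omega⟩ : Fin p)) = s := by
  exact Reach.all hn _ s
end

section
/- Let A, B, C be complete DFAs over a common alphabet Σ and let D = A·(B∪C) be the catenation DFA of A with the product DFA of B and C equipped with union (disjunction) acceptance; the states of D are pairs (i,T) with i a state of A and T a set of pairs of states of B and C. Suppose (x,x') ∈ T' and (y,y') ∈ T' and T = T' ∪ {(x,y')}. Then for every state i of A, the states (i,T) and (i,T') of D are equivalent. -/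
/-- Product DFA of two DFAs, with acceptance given by applying the boolean
connective `o` to the two components' acceptance. -/
def prodDFA {α σB σC : Type} (B : DFA α σB) (C : DFA α σC) (o : Prop → Prop → Prop) :
    DFA α (σB × σC) where
  step q x := (B.step q.1 x, C.step q.2 x)
  start := (B.start, C.start)
  accept := {q | o (q.1 ∈ B.accept) (q.2 ∈ C.accept)}

open Classical in
/-- Catenation DFA of two DFAs. -/
noncomputable def catDFA {α σA σM : Type} (A : DFA α σA) (M : DFA α σM) :
    DFA α (σA × Set σM) where
  step q x :=
    (A.step q.1 x,
      if A.step q.1 x ∈ A.accept then (fun s => M.step s x) '' q.2 ∪ {M.start}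
      else (fun s => M.step s x) '' q.2)
  start := (A.start, if A.start ∈ A.accept then {M.start} else ∅)
  accept := {q | (q.2 ∩ M.accept).Nonempty}

/-- Two states of a DFA are equivalent if no word separates them. -/
def equivStates {α σ : Type} (D : DFA α σ) (q₁ q₂ : σ) : Prop :=
  ∀ w : List α, (D.evalFrom q₁ w ∈ D.accept ↔ D.evalFrom q₂ w ∈ D.accept)

theorem statement6 {α σA σB σC : Type} (A : DFA α σA) (B : DFA α σB) (C : DFA α σC)
    (T T' : Set (σB × σC)) (x y : σB) (x' y' : σC)
    (hxx' : (x, x') ∈ T') (hyy' : (y, y') ∈ T') (hT : T = T' ∪ {(x, y')}) (i : σA) :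
    equivStates (catDFA A (prodDFA B C Or)) (i, T) (i, T') := by
  intro w
  induction w generalizing T T' x y x' y' i with
  | nil =>
    subst hT
    constructor
    · rintro ⟨q, hq | hq, hacc⟩
      · exact ⟨q, hq, hacc⟩
      · rw [Set.mem_singleton_iff] at hq
        subst hq
        rcases hacc with hB | hC
        · exact ⟨(x, x'), hxx', Or.inl hB⟩
        · exact ⟨(y, y'), hyy', Or.inr hC⟩
    · rintro ⟨q, hq, hacc⟩
      exact ⟨q, Or.inl hq, hacc⟩
  | cons a w ih =>
    refine ih _ _ (B.step x a) (B.step y a) (C.step x' a) (C.step y' a) ?_ ?_ ?_ (A.step i a)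
    · have h := Set.mem_image_of_mem (fun s => (prodDFA B C Or).step s a) hxx'
      split_ifs
      · exact Or.inl h
      · exact h
    · have h := Set.mem_image_of_mem (fun s => (prodDFA B C Or).step s a) hyy'
      split_ifs
      · exact Or.inl h
      · exact h
    · subst hT
      simp only [Set.image_union, Set.image_singleton]
      split_ifs
      · exact Set.union_right_comm _ _ _
      · rfl
end

section
/- Let A, B, C be complete DFAs over a common alphabet Σ and let D = A·(B⊕C) be the catenation DFA of A with the product DFA of B and C equipped with exclusive-or acceptance; the states of D are pairs (i,T) with i a state of A and T a set of pairs of states of B and C. Suppose (x,x') ∈ T', (x,y') ∈ T' and (y,y') ∈ T', and T = T' ∪ {(y,x')}. Then for every state i of A, the states (i,T) and (i,T') of D are equivalent. -/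
/-- If one corner of a square of exclusive disjunctions holds, so does one of the others. -/
theorem xor_square {p p' q q' : Prop} (h : Xor q q') : Xor p q' ∨ Xor p p' ∨ Xor q p' := by
  unfold Xor at *
  tauto

theorem mem_catDFA_step {α σA σM : Type} (A : DFA α σA) (M : DFA α σM) (i : σA) (a : α)
    {S : Set σM} {s : σM} (hs : s ∈ S) :
    M.step s a ∈ ((catDFA A M).step (i, S) a).2 := by
  have h : M.step s a ∈ (fun s => M.step s a) '' S := ⟨s, hs, rfl⟩
  simp only [catDFA]
  split_ifs
  · exact Or.inl h
  · exact h

theorem catDFA_step_union_singleton {α σA σM : Type} (A : DFA α σA) (M : DFA α σM) (i : σA)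
    (a : α) (S : Set σM) (s : σM) :
    (catDFA A M).step (i, S ∪ {s}) a =
      (A.step i a, ((catDFA A M).step (i, S) a).2 ∪ {M.step s a}) := by
  simp only [catDFA, Set.image_union, Set.image_singleton]
  split_ifs
  · rw [Set.union_right_comm]
  · rfl

theorem statement7 {α σA σB σC : Type} (A : DFA α σA) (B : DFA α σB) (C : DFA α σC)
    (T T' : Set (σB × σC)) (x y : σB) (x' y' : σC)
    (hxx' : (x, x') ∈ T') (hxy' : (x, y') ∈ T') (hyy' : (y, y') ∈ T')
    (hT : T = T' ∪ {(y, x')}) (i : σA) :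
    equivStates (catDFA A (prodDFA B C Xor')) (i, T) (i, T') := by
  subst hT
  intro w
  induction w generalizing T' x y x' y' i with
  | nil =>
    simp only [DFA.evalFrom_nil]
    constructor
    · rintro ⟨p, hp | rfl, hacc⟩
      · exact ⟨p, hp, hacc⟩
      · rcases xor_square hacc (p := x ∈ B.accept) (p' := y' ∈ C.accept) with h | h | h
        · exact ⟨(x, x'), hxx', h⟩
        · exact ⟨(x, y'), hxy', h⟩
        · exact ⟨(y, y'), hyy', h⟩
    · rintro ⟨p, hp, hacc⟩
      exact ⟨p, Or.inl hp, hacc⟩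
  | cons a w ih =>
    have h := ih ((catDFA A (prodDFA B C Xor)).step (i, T') a).2
      (B.step x a) (B.step y a) (C.step x' a) (C.step y' a)
      (mem_catDFA_step A _ i a hxx') (mem_catDFA_step A _ i a hxy')
      (mem_catDFA_step A _ i a hyy') (A.step i a)
    rw [DFA.evalFrom_cons, DFA.evalFrom_cons, catDFA_step_union_singleton]
    exact h
end

section
/- Let m,n,p ≥ 3 and let R be the catenation DFA A·(B×C) where A = X_m(a,b,−;{c}), B = X_n(b,a,c;∅), C = X_p(b,−,c;{a}) over the alphabet {a,b,c}; the states of R are pairs (i,T) with 0 ≤ i ≤ m−1 and T ⊆ {0,…,n−1}×{0,…,p−1}. Then for every state (i,{(j,k)}) with i ≠ m−1 there exists a word w ∈ {a,b}* (using only the letters a and b) such that (m−1,{(0,0)})·w = (i,{(j,k)}). -/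
/-- The three-letter alphabet `{a,b,c}`. -/
inductive ABC | a | b | c

/-- `X_m(a,b,−;{c})`: `a` the cycle, `b` the transposition, `c` the identity. -/
def XA (m : ℕ) (hm : 0 < m) : DFA ABC (Fin m) :=
  brzDFA m hm (fun x q => match x with | ABC.a => cyc q | ABC.b => transp q | ABC.c => q)

/-- `X_n(b,a,c;∅)`: `b` the cycle, `a` the transposition, `c` the contraction. -/
def XB (n : ℕ) (hn : 0 < n) : DFA ABC (Fin n) :=
  brzDFA n hn (fun x q => match x with | ABC.a => transp q | ABC.b => cyc q | ABC.c => contr q)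

/-- `X_p(b,−,c;{a})`: `b` the cycle, `c` the contraction, `a` the identity. -/
def XC (p : ℕ) (hp : 0 < p) : DFA ABC (Fin p) :=
  brzDFA p hp (fun x q => match x with | ABC.a => q | ABC.b => cyc q | ABC.c => contr q)

theorem cyc_val {n : ℕ} (i : Fin n) :
    (cyc i).val = if i.val + 1 = n then 0 else i.val + 1 := by
  have := i.isLt
  unfold cyc
  split_ifs with h
  · simp [h]
  · exact Nat.mod_eq_of_lt (by omega)

theorem transp_val {n : ℕ} (hn : 2 ≤ n) (i : Fin n) :
    (transp i).val = if i.val = 0 then 1 else if i.val = 1 then 0 else i.val := by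
  unfold transp
  split_ifs
  · exact Nat.mod_eq_of_lt (by omega)
  · rfl
  · rfl

theorem transp_injective {n : ℕ} (hn : 2 ≤ n) :
    Function.Injective (transp : Fin n → Fin n) := by
  intro i j h
  have h' := congrArg Fin.val h
  simp only [transp_val hn] at h'
  ext
  split_ifs at h' <;> omega

/-- A subset of a finite type stable under an injective map is also stable under preimages. -/
theorem mem_of_apply_mem {α : Type*} [Finite α] {f : α → α} (hf : Function.Injective f)
    {S : Set α} (hS : ∀ x ∈ S, f x ∈ S) {x : α} (hx : f x ∈ S) : x ∈ S := by
  obtain ⟨r, hr, hper⟩ := hf.mem_periodicPts x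
  have hiter : ∀ t, f^[t] (f x) ∈ S := by
    intro t
    induction t with
    | zero => exact hx
    | succ t ih =>
      rw [Function.iterate_succ_apply']
      exact hS _ ih
  have h := hiter (r - 1)
  rw [← Function.iterate_succ_apply, Nat.succ_eq_add_one, Nat.sub_add_cancel hr] at h
  exact hper.eq ▸ h

/-- The permutations induced by the words `bb` and `ab` act transitively on
`{0,…,n−1} × {0,…,p−1}`. -/
theorem mem_of_stable {n p : ℕ} (hn : 3 ≤ n) (S : Set (Fin n × Fin p))
    (hbb : ∀ j k, (j, k) ∈ S → (cyc (cyc j), cyc (cyc k)) ∈ S)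
    (hab : ∀ j k, (j, k) ∈ S → (cyc (transp j), cyc k) ∈ S)
    (h : ∃ k, ((⟨1, by omega⟩ : Fin n), k) ∈ S) (j : Fin n) (k : Fin p) : (j, k) ∈ S := by
  have hbb' : ∀ j k, (cyc (cyc j), cyc (cyc k)) ∈ S → (j, k) ∈ S := fun j k hjk =>
    mem_of_apply_mem (f := fun q : Fin n × Fin p => (cyc (cyc q.1), cyc (cyc q.2)))
      ((cyc_injective.comp cyc_injective).prodMap (cyc_injective.comp cyc_injective))
      (fun q hq => hbb q.1 q.2 hq) hjk
  have hab' : ∀ j k, (cyc (transp j), cyc k) ∈ S → (j, k) ∈ S := fun j k hjk =>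
    mem_of_apply_mem (f := fun q : Fin n × Fin p => (cyc (transp q.1), cyc q.2))
      ((cyc_injective.comp (transp_injective (by omega))).prodMap cyc_injective)
      (fun q hq => hab q.1 q.2 hq) hjk
  have bb : ∀ j j' : Fin n, cyc (cyc j) = j' → ((∀ k, (j, k) ∈ S) ↔ ∀ k, (j', k) ∈ S) := by
    rintro j _ rfl
    refine ⟨fun H k => ?_, fun H k => hbb' _ _ (H _)⟩
    obtain ⟨k, rfl⟩ := cyc_surjective k
    obtain ⟨k, rfl⟩ := cyc_surjective k
    exact hbb _ _ (H k)
  have ab : ∀ j j' : Fin n, cyc (transp j) = j' → ((∀ k, (j, k) ∈ S) ↔ ∀ k, (j', k) ∈ S) := by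
    rintro j _ rfl
    refine ⟨fun H k => ?_, fun H k => hab' _ _ (H _)⟩
    obtain ⟨k, rfl⟩ := cyc_surjective k
    exact hab _ _ (H k)
  have one : ∀ k, ((⟨1, by omega⟩ : Fin n), k) ∈ S := by
    obtain ⟨k₀, hk₀⟩ := h
    have fixed : cyc (transp (⟨1, by omega⟩ : Fin n)) = ⟨1, by omega⟩ := by
      ext
      simp only [cyc_val, transp_val (show 2 ≤ n by omega)]
      grind
    have hup : ∀ k, ((⟨1, by omega⟩ : Fin n), k) ∈ S → ((⟨1, by omega⟩ : Fin n), cyc k) ∈ S := by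
      intro k hk
      have := hab _ _ hk
      rwa [fixed] at this
    have hdown : ∀ k, ((⟨1, by omega⟩ : Fin n), cyc k) ∈ S → ((⟨1, by omega⟩ : Fin n), k) ∈ S :=
      fun k hk => hab' _ _ (by rwa [fixed])
    have hp : 0 < p := k₀.pos
    have zero_of : ∀ t (ht : t < p), ((⟨1, by omega⟩ : Fin n), (⟨t, ht⟩ : Fin p)) ∈ S ↔
        ((⟨1, by omega⟩ : Fin n), (⟨0, hp⟩ : Fin p)) ∈ S := by
      intro t
      induction t with
      | zero => exact fun _ => Iff.rfl
      | succ t ih =>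
        intro ht
        have e : (⟨t + 1, ht⟩ : Fin p) = cyc ⟨t, by omega⟩ := by
          ext
          simp only [cyc_val]
          split_ifs <;> omega
        rw [← ih (by omega), e]
        exact ⟨hdown _, hup _⟩
    exact fun k => (zero_of k.1 k.2).2 ((zero_of k₀.1 k₀.2).1 hk₀)
  have two_iff_zero : (∀ k, ((⟨0, by omega⟩ : Fin n), k) ∈ S) ↔
      ∀ k, ((⟨2, by omega⟩ : Fin n), k) ∈ S := by
    apply bb
    ext
    simp only [cyc_val]
    split_ifs <;> omega
  have two : ∀ k, ((⟨2, by omega⟩ : Fin n), k) ∈ S := by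
    obtain rfl | hn' : n = 3 ∨ 4 ≤ n := by omega
    · exact two_iff_zero.1 ((bb ⟨1, by omega⟩ _ (Fin.ext (by simp [cyc_val]))).1 one)
    · have three : ∀ k, ((⟨3, by omega⟩ : Fin n), k) ∈ S := by
        refine (bb ⟨1, by omega⟩ _ ?_).1 one
        ext
        simp only [cyc_val]
        split_ifs <;> omega
      refine (ab _ ⟨3, by omega⟩ ?_).2 three
      ext
      simp only [cyc_val, transp_val (show 2 ≤ n by omega)]
      grind
  have ge_two : ∀ t (ht : t + 2 < n), ∀ k, ((⟨t + 2, ht⟩ : Fin n), k) ∈ S := by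
    intro t
    induction t with
    | zero => exact fun _ => two
    | succ t ih =>
      intro ht
      refine (ab ⟨t + 2, by omega⟩ _ ?_).1 (ih _)
      ext
      simp only [cyc_val, transp_val (show 2 ≤ n by omega)]
      grind
  obtain ⟨t, ht⟩ := j
  match t, ht with
  | 0, _ => exact two_iff_zero.2 two k
  | 1, _ => exact one k
  | t + 2, ht => exact ge_two t ht k

/-- In a catenation DFA, a transition not entering a final state of the first automaton keeps the
second component a singleton. -/
theorem catDFA_step_singleton {α σA σM : Type} (A : DFA α σA) (M : DFA α σM) (i : σA) (q : σM)
    (x : α) (h : A.step i x ∉ A.accept) :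
    (catDFA A M).step (i, {q}) x = (A.step i x, {M.step q x}) := by
  simp [catDFA, h]

theorem statement8 (m n p : ℕ) (hm : 3 ≤ m) (hn : 3 ≤ n) (hp : 3 ≤ p)
    (i : Fin m) (hi : i.val ≠ m - 1) (j : Fin n) (k : Fin p) :
    ∃ w : List ABC, (∀ x ∈ w, x = ABC.a ∨ x = ABC.b) ∧
      (catDFA (XA m (by omega)) (prodDFA (XB n (by omega)) (XC p (by omega)) And)).evalFrom
          ((⟨m - 1, by omega⟩ : Fin m),
            ({((⟨0, by omega⟩ : Fin n), (⟨0, by omega⟩ : Fin p))} : Set (Fin n × Fin p))) w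
        = (i, ({(j, k)} : Set (Fin n × Fin p))) := by
  let D := catDFA (XA m (by omega)) (prodDFA (XB n (by omega)) (XC p (by omega)) And)
  let reach : Fin m → Fin n → Fin p → Prop := fun i j k =>
    ∃ w : List ABC, (∀ x ∈ w, x = ABC.a ∨ x = ABC.b) ∧
      D.evalFrom ((⟨m - 1, by omega⟩ : Fin m),
            ({((⟨0, by omega⟩ : Fin n), (⟨0, by omega⟩ : Fin p))} : Set (Fin n × Fin p))) w
        = (i, ({(j, k)} : Set (Fin n × Fin p)))
  have step_a : ∀ i i' j k, cyc i = i' → i'.val ≠ m - 1 → reach i j k →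
      reach i' (transp j) k := by
    rintro i _ j k rfl hne ⟨w, hw, he⟩
    refine ⟨w ++ [ABC.a], ?_, ?_⟩
    · intro x hx
      rcases List.mem_append.1 hx with hx | hx
      · exact hw x hx
      · exact Or.inl (List.mem_singleton.1 hx)
    · rw [DFA.evalFrom_append_singleton, he]
      exact catDFA_step_singleton _ _ _ _ _ fun h => hne (congrArg Fin.val h)
  have step_b : ∀ i i' j k, transp i = i' → i'.val ≠ m - 1 → reach i j k →
      reach i' (cyc j) (cyc k) := by
    rintro i _ j k rfl hne ⟨w, hw, he⟩
    refine ⟨w ++ [ABC.b], ?_, ?_⟩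
    · intro x hx
      rcases List.mem_append.1 hx with hx | hx
      · exact hw x hx
      · exact Or.inr (List.mem_singleton.1 hx)
    · rw [DFA.evalFrom_append_singleton, he]
      exact catDFA_step_singleton _ _ _ _ _ fun h => hne (congrArg Fin.val h)
  have h01 : transp (⟨0, by omega⟩ : Fin m) = ⟨1, by omega⟩ := by
    ext; simp [transp_val (show 2 ≤ m by omega)]
  have h10 : transp (⟨1, by omega⟩ : Fin m) = ⟨0, by omega⟩ := by
    ext; simp [transp_val (show 2 ≤ m by omega)]
  have hc : ∀ t (ht : t + 1 < m), cyc (⟨t, by omega⟩ : Fin m) = ⟨t + 1, ht⟩ := by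
    intro t ht
    ext
    simp only [cyc_val]
    split_ifs <;> omega
  have ne0 : (⟨0, by omega⟩ : Fin m).val ≠ m - 1 := by simp only; omega
  have ne1 : (⟨1, by omega⟩ : Fin m).val ≠ m - 1 := by simp only; omega
  have reach_zero : ∀ j k, reach ⟨0, by omega⟩ j k := by
    intro j k
    refine mem_of_stable hn {q | reach ⟨0, by omega⟩ q.1 q.2} ?_ ?_ ?_ j k
    · exact fun j k h => step_b _ _ _ _ h10 ne0 (step_b _ _ _ _ h01 ne1 h)
    · exact fun j k h => step_b _ _ _ _ h10 ne0 (step_a _ _ _ _ (hc 0 (by omega)) ne1 h)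
    · refine ⟨⟨0, by omega⟩, ?_⟩
      have hlast : cyc (⟨m - 1, by omega⟩ : Fin m) = ⟨0, by omega⟩ := by
        ext
        simp only [cyc_val]
        split_ifs <;> omega
      have htr : transp (⟨0, by omega⟩ : Fin n) = ⟨1, by omega⟩ := by
        ext; simp [transp_val (show 2 ≤ n by omega)]
      have hstart : reach ⟨m - 1, by omega⟩ ⟨0, by omega⟩ ⟨0, by omega⟩ := ⟨[], by simp, rfl⟩
      have := step_a _ _ _ _ hlast ne0 hstart
      rwa [htr] at this
  have reach_lt : ∀ t (ht : t < m - 1), ∀ j k, reach ⟨t, by omega⟩ j k := by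
    intro t
    induction t with
    | zero => exact fun _ => reach_zero
    | succ t ih =>
      intro ht j k
      obtain ⟨j, rfl⟩ := Finite.surjective_of_injective (transp_injective (n := n) (by omega)) j
      exact step_a _ _ _ _ (hc t (by omega)) (by simp only; omega) (ih (by omega) j k)
  exact reach_lt i.val (by have := i.isLt; omega) j k
end

section
/- Let A, B, C be complete DFAs over a common alphabet Σ and let D = A·(B∪C) be the catenation DFA of A with the product DFA of B and C equipped with union (disjunction) acceptance; the states of D are pairs (i,T) with i a state of A and T a set of pairs of states of B and C. For such a T define sat(T) = {j : (j,k) ∈ T for some k} × {k : (j,k) ∈ T for some j}. Then every state (i,T) of D is equivalent to the state (i, sat(T)). -/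
/-- Saturation of a tableau: the cartesian product of its set of rows and set of
columns. -/
def sat {σB σC : Type} (T : Set (σB × σC)) : Set (σB × σC) :=
  {j | ∃ k, (j, k) ∈ T} ×ˢ {k | ∃ j, (j, k) ∈ T}

/-- Acceptance in a catenation with a union depends only on the two coordinate projections
of the tableau. -/
theorem equivStates_catDFA_of_image_eq {α σA σB σC : Type} (A : DFA α σA) (B : DFA α σB)
    (C : DFA α σC) (i : σA) {S T : Set (σB × σC)} (hfst : Prod.fst '' S = Prod.fst '' T)
    (hsnd : Prod.snd '' S = Prod.snd '' T) :
    equivStates (catDFA A (prodDFA B C Or)) (i, S) (i, T) := by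
  intro w
  induction w generalizing i S T with
  | nil =>
    have key (U : Set (σB × σC)) : (U ∩ (prodDFA B C Or).accept).Nonempty ↔
        (Prod.fst '' U ∩ B.accept).Nonempty ∨ (Prod.snd '' U ∩ C.accept).Nonempty := by
      simp only [Set.image_inter_nonempty_iff, ← Set.union_nonempty, ← Set.inter_union_distrib_left]
      rfl
    change (S ∩ (prodDFA B C Or).accept).Nonempty ↔ (T ∩ (prodDFA B C Or).accept).Nonempty
    rw [key, key, hfst, hsnd]
  | cons x w ih =>
    have hB (U : Set (σB × σC)) : Prod.fst '' ((fun s => (prodDFA B C Or).step s x) '' U) =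
        (fun q => B.step q x) '' (Prod.fst '' U) := by
      simp only [Set.image_image, prodDFA]
    have hC (U : Set (σB × σC)) : Prod.snd '' ((fun s => (prodDFA B C Or).step s x) '' U) =
        (fun q => C.step q x) '' (Prod.snd '' U) := by
      simp only [Set.image_image, prodDFA]
    simp only [DFA.evalFrom_cons]
    apply ih
    · split_ifs <;> simp only [Set.image_union, hB, hfst]
    · split_ifs <;> simp only [Set.image_union, hC, hsnd]

theorem image_fst_sat {σB σC : Type} (T : Set (σB × σC)) :
    Prod.fst '' sat T = Prod.fst '' T := by
  ext j
  simp only [sat, Set.mem_image, Set.mem_prod, Set.mem_ofPred_eq, Prod.exists]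
  grind

theorem image_snd_sat {σB σC : Type} (T : Set (σB × σC)) :
    Prod.snd '' sat T = Prod.snd '' T := by
  ext k
  simp only [sat, Set.mem_image, Set.mem_prod, Set.mem_ofPred_eq, Prod.exists]
  grind

theorem statement12 {α σA σB σC : Type} (A : DFA α σA) (B : DFA α σB) (C : DFA α σC)
    (i : σA) (T : Set (σB × σC)) :
    equivStates (catDFA A (prodDFA B C Or)) (i, T) (i, sat T) :=
  equivStates_catDFA_of_image_eq A B C i (image_fst_sat T).symm (image_snd_sat T).symm
end

section
/- Let m,n ≥ 3 and consider the DFA over alphabet {a,b,c} with state set {0,…,m−1}×{0,…,n−1} obtained as the product of X_m(a,b,−;{c}) and X_n(a,c,−;{b}) (componentwise transitions: a sends (i,j) to (i+1 mod m, j+1 mod n); b sends (i,j) to (τ_m(i), j) where τ_m swaps 0 and 1 in the first component; c sends (i,j) to (i, τ_n(j)) where τ_n swaps 0 and 1 in the second component). For each boolean connective ⊙ among disjunction, conjunction and exclusive-or, declare a state (i,j) final when (i = m−1) ⊙ (j = n−1) holds. Then for every such choice of ⊙, any two distinct states are distinguishable. -/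
/-- `X_m(a,b,−;{c})`: `a` the cycle, `b` the transposition, `c` the identity. -/
def YA (m : ℕ) (hm : 0 < m) : DFA ABC (Fin m) :=
  brzDFA m hm (fun x q => match x with | ABC.a => cyc q | ABC.b => transp q | ABC.c => q)

/-- `X_n(a,c,−;{b})`: `a` the cycle, `c` the transposition, `b` the identity. -/
def YB (n : ℕ) (hn : 0 < n) : DFA ABC (Fin n) :=
  brzDFA n hn (fun x q => match x with | ABC.a => cyc q | ABC.b => q | ABC.c => transp q)

/-- `X_p(a,−,b;{c})`: `a` the cycle, `b` the contraction, `c` the identity. -/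
def YC (p : ℕ) (hp : 0 < p) : DFA ABC (Fin p) :=
  brzDFA p hp (fun x q => match x with | ABC.a => cyc q | ABC.b => contr q | ABC.c => q)

open Equiv

theorem Subgroup.mk_one_mem_of_finRotate_mem {k : ℕ} {G : Type*} [Group G]
    (H : Subgroup (Perm (Fin (k + 2)) × G)) {g : G} (hrot : (finRotate (k + 2), g) ∈ H)
    (hswap : (swap (0 : Fin (k + 2)) 1, (1 : G)) ∈ H) (π : Perm (Fin (k + 2))) :
    (π, (1 : G)) ∈ H := by
  let N : Subgroup (Perm (Fin (k + 2))) := H.comap (MonoidHom.inl _ _)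
  have hadj : ∀ i (hi : i < k + 1),
      swap (Fin.castSucc ⟨i, hi⟩ : Fin (k + 2)) (Fin.succ ⟨i, hi⟩) ∈ N := by
    intro i
    induction i with
    | zero => exact fun _ => hswap
    | succ i ih =>
      intro hi
      have h := H.mul_mem (H.mul_mem hrot (ih (by omega))) (H.inv_mem hrot)
      have e1 : finRotate (k + 2) (Fin.castSucc ⟨i, by omega⟩) = Fin.castSucc ⟨i + 1, hi⟩ := by
        rw [finRotate_apply, Fin.coeSucc_eq_succ]; rfl
      have e2 : finRotate (k + 2) (Fin.succ ⟨i, by omega⟩) = Fin.succ ⟨i + 1, hi⟩ := by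
        rw [finRotate_apply]
        have := Fin.coeSucc_eq_succ (a := (⟨i + 1, hi⟩ : Fin (k + 1)))
        exact this
      have hc := swap_apply_apply (finRotate (k + 2)) (Fin.castSucc ⟨i, by omega⟩)
        (Fin.succ ⟨i, by omega⟩)
      rw [e1, e2] at hc
      change (_, (1 : G)) ∈ H
      rw [hc]
      simpa using h
  have htop : Submonoid.closure (Set.range fun i : Fin (k + 1) => swap i.castSucc i.succ)
      ≤ N.toSubmonoid := by
    rw [Submonoid.closure_le]
    rintro _ ⟨i, rfl⟩
    exact hadj i.1 i.2
  rw [Perm.mclosure_swap_castSucc_succ] at htop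
  exact htop (Submonoid.mem_top π)

/-- The pairs of permutations induced on the two components by words. -/
def wordPerms (m n : ℕ) (hm : 0 < m) (hn : 0 < n) (o : Prop → Prop → Prop) :
    Subgroup (Perm (Fin m) × Perm (Fin n)) :=
  let W : Submonoid (Perm (Fin m) × Perm (Fin n)) :=
    { carrier := {p | ∃ w, ∀ q,
        (prodDFA (YA m hm) (YB n hn) o).evalFrom q w = (p.1 q.1, p.2 q.2)}
      one_mem' := ⟨[], fun _ => rfl⟩
      mul_mem' := by
        rintro p p' ⟨w, hw⟩ ⟨w', hw'⟩
        exact ⟨w' ++ w, fun q => by rw [DFA.evalFrom_of_append, hw', hw]; rfl⟩ }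
  { W with
    inv_mem' := by
      intro p hp
      obtain ⟨j, hj⟩ := (isOfFinOrder_of_finite p).mem_powers_iff_mem_zpowers.2
        (inv_mem (Subgroup.mem_zpowers p))
      change p⁻¹ ∈ W
      rw [← hj]
      exact W.pow_mem hp j }

theorem cyc_eq_finRotate {k : ℕ} (i : Fin (k + 2)) : cyc i = finRotate (k + 2) i := by
  rw [finRotate_apply]
  ext
  simp [cyc, Fin.val_add]

theorem transp_eq_swap {k : ℕ} (i : Fin (k + 2)) : transp i = swap 0 1 i := by
  rw [swap_apply_def]
  unfold transp
  have h0 : i = 0 ↔ i.val = 0 := Fin.ext_iff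
  have h1 : i = 1 ↔ i.val = 1 := Fin.ext_iff
  simp only [h0, h1]
  split_ifs <;> ext <;> simp

theorem wordPerms_eq_top {m n : ℕ} (hm : 2 ≤ m) (hn : 2 ≤ n) (o : Prop → Prop → Prop) :
    wordPerms m n (by omega) (by omega) o = ⊤ := by
  obtain ⟨k, rfl⟩ := Nat.exists_eq_add_of_le' hm
  obtain ⟨l, rfl⟩ := Nat.exists_eq_add_of_le' hn
  set H := wordPerms (k + 2) (l + 2) (by omega) (by omega) o
  have ha : (finRotate (k + 2), finRotate (l + 2)) ∈ H :=
    ⟨[ABC.a], fun q => Prod.ext (cyc_eq_finRotate q.1) (cyc_eq_finRotate q.2)⟩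
  have hb : (swap (0 : Fin (k + 2)) 1, (1 : Perm (Fin (l + 2)))) ∈ H :=
    ⟨[ABC.b], fun q => Prod.ext (transp_eq_swap q.1) rfl⟩
  have hc : ((1 : Perm (Fin (k + 2))), swap (0 : Fin (l + 2)) 1) ∈ H :=
    ⟨[ABC.c], fun q => Prod.ext rfl (transp_eq_swap q.2)⟩
  refine eq_top_iff.2 fun p _ => ?_
  have h1 := H.mk_one_mem_of_finRotate_mem ha hb p.1
  have h2 : ((1 : Perm (Fin (k + 2))), p.2) ∈ H :=
    (H.comap (MulEquiv.prodComm (M := Perm (Fin (l + 2)))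
      (N := Perm (Fin (k + 2)))).toMonoidHom).mk_one_mem_of_finRotate_mem ha hc p.2
  simpa using H.mul_mem h1 h2

theorem exists_word_evalFrom_eq {m n : ℕ} (hm : 2 ≤ m) (hn : 2 ≤ n) (o : Prop → Prop → Prop)
    (π : Perm (Fin m)) (σ : Perm (Fin n)) :
    ∃ w, ∀ q, (prodDFA (YA m (by omega)) (YB n (by omega)) o).evalFrom q w
      = (π q.1, σ q.2) := by
  have h : (π, σ) ∈ wordPerms m n (by omega) (by omega) o := by
    rw [wordPerms_eq_top hm hn]; trivial
  exact h

theorem Equiv.Perm.exists_apply_eq_apply_ne {α : Type*} [DecidableEq α] {i i' : α} (h : i ≠ i')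
    (t : α) : ∃ π : Perm α, π i = t ∧ π i' ≠ t :=
  ⟨swap i t, swap_apply_left i t, fun h' =>
    h ((swap i t).injective ((swap_apply_left i t).trans h'.symm))⟩

theorem Equiv.Perm.exists_apply_ne_apply_ne {n : ℕ} (hn : 3 ≤ n) (j j' t : Fin n) :
    ∃ σ : Perm (Fin n), σ j ≠ t ∧ σ j' ≠ t := by
  obtain ⟨z, hz⟩ := Finset.exists_mem_notMem_of_card_lt_card (s := {j, j'})
    (t := (Finset.univ : Finset (Fin n)))
    (lt_of_le_of_lt Finset.card_le_two (by simpa using Nat.lt_of_succ_le hn))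
  simp only [Finset.mem_univ, Finset.mem_insert, Finset.mem_singleton, not_or, true_and] at hz
  have key : ∀ x, z ≠ x → swap z t x ≠ t := fun x hx h' =>
    hx ((swap z t).injective ((swap_apply_left z t).trans h'.symm))
  exact ⟨swap z t, key j hz.1, key j' hz.2⟩

theorem statement13 (m n : ℕ) (hm : 3 ≤ m) (hn : 3 ≤ n)
    (o : Prop → Prop → Prop) (ho : o = Or ∨ o = And ∨ o = Xor')
    (s s' : Fin m × Fin n) (hss' : s ≠ s') :
    ∃ w : List ABC,
      Xor' ((prodDFA (YA m (by omega)) (YB n (by omega)) o).evalFrom s w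
          ∈ (prodDFA (YA m (by omega)) (YB n (by omega)) o).accept)
        ((prodDFA (YA m (by omega)) (YB n (by omega)) o).evalFrom s' w
          ∈ (prodDFA (YA m (by omega)) (YB n (by omega)) o).accept) := by
  obtain ⟨i, j⟩ := s
  obtain ⟨i', j'⟩ := s'
  let tm : Fin m := ⟨m - 1, by omega⟩
  let tn : Fin n := ⟨n - 1, by omega⟩
  suffices h : ∃ (π : Perm (Fin m)) (σ : Perm (Fin n)),
      Xor (o (π i = tm) (σ j = tn)) (o (π i' = tm) (σ j' = tn)) by
    obtain ⟨π, σ, h⟩ := h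
    obtain ⟨w, hw⟩ := exists_word_evalFrom_eq (by omega) (by omega) o π σ
    refine ⟨w, ?_⟩
    rw [hw, hw]
    exact h
  by_cases hi : i = i'
  · have hj : j ≠ j' := fun hj => hss' (by rw [hi, hj])
    obtain ⟨σ, h1, h2⟩ := Perm.exists_apply_eq_apply_ne hj tn
    obtain ⟨π, h3, h4⟩ := Perm.exists_apply_ne_apply_ne hm i i' tm
    rcases ho with rfl | rfl | rfl
    · exact ⟨π, σ, by simp [Xor, h1, h2, h3, h4]⟩
    · exact ⟨swap i tm, σ, by simp [Xor, h1, h2]⟩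
    · exact ⟨π, σ, by simp [Xor', Xor, h1, h2, h3, h4]⟩
  · obtain ⟨π, h1, h2⟩ := Perm.exists_apply_eq_apply_ne hi tm
    obtain ⟨σ, h3, h4⟩ := Perm.exists_apply_ne_apply_ne hn j j' tn
    rcases ho with rfl | rfl | rfl
    · exact ⟨π, σ, by simp [Xor, h1, h2, h3, h4]⟩
    · exact ⟨π, swap j tn, by simp [Xor, h1, h2]⟩
    · exact ⟨π, σ, by simp [Xor', Xor, h1, h2, h3, h4]⟩
end
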